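/- Let R be an Abelian exchange ring and G a locally finite group. If R has no factor ring isomorphic to ℤ/2ℤ (there is no surjective ring homomorphism from R onto the field with two elements), then every element of the group ring RG is a sum of two units of RG. -/

import Mathlib

/-- `x` is a sum of two units. -/
def STU {A : Type*} [Ring A] (x : A) : Prop := ∃ u v : A, IsUnit u ∧ IsUnit v ∧ x = u + v

lemma STU.map {A B : Type*} [Ring A] [Ring B] (f : A →+* B) {x : A} (h : STU x) : STU (f x) := by
  obtain ⟨u, v, hu, hv, rfl⟩ := h
  exact ⟨f u, f v, hu.map f, hv.map f, map_add f u v⟩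

lemma isUnit_of_sub_one_mem_jac {A : Type*} [Ring A] {a : A} (h : a - 1 ∈ Ring.jacobson A) :
    IsUnit a := by
  have key : ∀ b : A, b - 1 ∈ Ring.jacobson A → ∃ z, z * b = 1 := by
    intro b hb
    rw [← Ideal.jacobson_bot, Ideal.mem_jacobson_iff] at hb
    obtain ⟨z, hz⟩ := hb 1
    rw [Ideal.mem_bot] at hz
    refine ⟨z, ?_⟩
    rw [← sub_eq_zero, ← hz]; noncomm_ring
  obtain ⟨z, hz⟩ := key a h
  obtain ⟨w, hw⟩ := key z (by
    have : z - 1 = -(z * (a - 1)) := by rw [mul_sub, hz]; noncomm_ring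
    rw [this]
    exact neg_mem (Ideal.mul_mem_left _ _ h))
  have : w = a := by
    calc w = w * (z * a) := by rw [hz, mul_one]
      _ = a := by rw [← mul_assoc, hw, one_mul]
  subst this
  exact ⟨⟨w, z, hw, hz⟩, rfl⟩

lemma isUnit_of_mul {A : Type*} [Ring A] {a b : A} (h1 : IsUnit (a * b)) (h2 : IsUnit (b * a)) :
    IsUnit a := by
  obtain ⟨p, hp⟩ := h1.exists_right_inv
  obtain ⟨q, hq⟩ := h2.exists_left_inv
  rw [mul_assoc] at hp
  rw [← mul_assoc] at hq
  have : q * b = b * p := by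
    calc q * b = (q * b) * (a * (b * p)) := by rw [hp, mul_one]
      _ = (q * b * a) * (b * p) := by noncomm_ring
      _ = b * p := by rw [hq, one_mul]
  exact ⟨⟨a, b * p, hp, this ▸ hq⟩, rfl⟩

/-- approximate solutions modulo the Jacobson radical can be lifted -/
lemma STU.of_jac {A : Type*} [Ring A] {x u u' v v' : A}
    (h : x - (u + v) ∈ Ring.jacobson A)
    (h1 : u * u' - 1 ∈ Ring.jacobson A) (h2 : u' * u - 1 ∈ Ring.jacobson A)
    (h3 : v * v' - 1 ∈ Ring.jacobson A) (h4 : v' * v - 1 ∈ Ring.jacobson A) : STU x := by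
  refine ⟨u, x - u, isUnit_of_mul (isUnit_of_sub_one_mem_jac h1) (isUnit_of_sub_one_mem_jac h2),
    isUnit_of_mul (b := v') (isUnit_of_sub_one_mem_jac ?_) (isUnit_of_sub_one_mem_jac ?_), by abel⟩
  · have : (x - u) * v' - 1 = (x - (u + v)) * v' + (v * v' - 1) := by noncomm_ring
    rw [this]
    exact add_mem (Ideal.mul_mem_right _ _ h) h3
  · have : v' * (x - u) - 1 = v' * (x - (u + v)) + (v' * v - 1) := by noncomm_ring
    rw [this]
    exact add_mem (Ideal.mul_mem_left _ _ h) h4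

lemma STU.of_quot_jac {A : Type*} [Ring A] {x : A}
    (h : STU (Ideal.Quotient.mk (Ring.jacobson A) x)) : STU x := by
  obtain ⟨u, v, ⟨⟨u, u', h1, h2⟩, rfl⟩, ⟨⟨v, v', h3, h4⟩, rfl⟩, hx⟩ := h
  obtain ⟨u, rfl⟩ := Ideal.Quotient.mk_surjective u
  obtain ⟨u', rfl⟩ := Ideal.Quotient.mk_surjective u'
  obtain ⟨v, rfl⟩ := Ideal.Quotient.mk_surjective v
  obtain ⟨v', rfl⟩ := Ideal.Quotient.mk_surjective v'
  have key : ∀ a b : A, Ideal.Quotient.mk (Ring.jacobson A) a = Ideal.Quotient.mk _ b →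
      a - b ∈ Ring.jacobson A := fun a b h => (Ideal.Quotient.mk_eq_mk_iff_sub_mem a b).1 h
  simp only [← map_mul, ← map_add] at h1 h2 h3 h4 hx
  rw [← map_one (Ideal.Quotient.mk (Ring.jacobson A))] at h1 h2 h3 h4
  exact STU.of_jac (key _ _ hx) (key _ _ h1) (key _ _ h2) (key _ _ h3) (key _ _ h4)

/-! ### Matrices -/

lemma isUnit_upper {S m n : Type*} [Ring S] [Fintype m] [Fintype n] [DecidableEq m] [DecidableEq n]
    {A : Matrix m m S} {D : Matrix n n S} (B : Matrix m n S) (hA : IsUnit A) (hD : IsUnit D) :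
    IsUnit (Matrix.fromBlocks A B 0 D) := by
  obtain ⟨⟨A, A', h1, h2⟩, rfl⟩ := hA
  obtain ⟨⟨D, D', h3, h4⟩, rfl⟩ := hD
  refine ⟨⟨Matrix.fromBlocks A B 0 D, Matrix.fromBlocks A' (-(A' * B * D')) 0 D', ?_, ?_⟩, rfl⟩
  · simp [Matrix.fromBlocks_multiply, h1, h3, ← Matrix.mul_assoc]
  · simp [Matrix.fromBlocks_multiply, h2, h4, Matrix.mul_assoc]

lemma isUnit_lower {S m n : Type*} [Ring S] [Fintype m] [Fintype n] [DecidableEq m] [DecidableEq n]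
    {A : Matrix m m S} {D : Matrix n n S} (C : Matrix n m S) (hA : IsUnit A) (hD : IsUnit D) :
    IsUnit (Matrix.fromBlocks A 0 C D) := by
  obtain ⟨⟨A, A', h1, h2⟩, rfl⟩ := hA
  obtain ⟨⟨D, D', h3, h4⟩, rfl⟩ := hD
  refine ⟨⟨Matrix.fromBlocks A 0 C D, Matrix.fromBlocks A' 0 (-(D' * C * A')) D', ?_, ?_⟩, rfl⟩
  · simp [Matrix.fromBlocks_multiply, h1, h3, ← Matrix.mul_assoc]
  · simp [Matrix.fromBlocks_multiply, h2, h4, Matrix.mul_assoc]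

lemma stu_matrix {S : Type*} [Ring S] (hS : ∀ s : S, STU s) (n : ℕ) :
    ∀ X : Matrix (Fin n) (Fin n) S, STU X := by
  induction n with
  | zero => exact fun X => ⟨0, 0, isUnit_of_subsingleton _, isUnit_of_subsingleton _,
      Subsingleton.elim _ _⟩
  | succ n ih =>
    have one : ∀ X : Matrix (Fin 1) (Fin 1) S, STU X := by
      intro X
      have := (hS (X 0 0)).map (Matrix.scalar (Fin 1))
      convert this
      ext i j
      fin_cases i; fin_cases j; simp
    have key : ∀ X : Matrix (Fin n ⊕ Fin 1) (Fin n ⊕ Fin 1) S, STU X := by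
      intro X
      obtain ⟨u, v, hu, hv, h⟩ := ih X.toBlocks₁₁
      obtain ⟨w, z, hw, hz, h'⟩ := one X.toBlocks₂₂
      refine ⟨_, _, isUnit_upper X.toBlocks₁₂ hu hw, isUnit_lower X.toBlocks₂₁ hv hz, ?_⟩
      rw [Matrix.fromBlocks_add, ← h, ← h', add_zero, zero_add, Matrix.fromBlocks_toBlocks]
    intro X
    let e := Matrix.reindexRingEquiv S (finSumFinEquiv (m := n) (n := 1))
    have := (key (e.symm X)).map e.toRingHom
    simpa using this

lemma stu_division {D : Type*} [DivisionRing D] {a : D} (h0 : a ≠ 0) (h1 : a ≠ 1) (x : D) :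
    STU x := by
  have : ∃ u : D, u ≠ 0 ∧ u ≠ x := by
    by_cases hx : x = 1
    · exact ⟨a, h0, hx ▸ h1⟩
    · exact ⟨1, one_ne_zero, Ne.symm hx⟩
  obtain ⟨u, hu, hux⟩ := this
  exact ⟨u, x - u, hu.isUnit, (sub_ne_zero.2 hux.symm).isUnit, by abel⟩

lemma stu_pi {ι : Type*} {A : ι → Type*} [∀ i, Ring (A i)] (x : ∀ i, A i)
    (h : ∀ i, STU (x i)) : STU x := by
  choose u v hu hv h using h
  exact ⟨u, v, Pi.isUnit_iff.2 hu, Pi.isUnit_iff.2 hv, funext h⟩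

/-! ### Group rings over division rings -/

instance {D G : Type*} [Ring D] [Group G] [Finite G] : Module.Finite D (MonoidAlgebra D G) :=
  Module.Finite.equiv (MonoidAlgebra.coeffLinearEquiv D).symm

lemma stu_groupRing_division {D G : Type*} [DivisionRing D] [Group G] [Finite G]
    {a : D} (h0 : a ≠ 0) (h1 : a ≠ 1) (x : MonoidAlgebra D G) : STU x := by
  have : IsArtinianRing (MonoidAlgebra D G) := IsArtinianRing.of_finite D _
  apply STU.of_quot_jac
  obtain ⟨n, D', d, _, hd, ⟨e⟩⟩ := IsSemisimpleRing.exists_ringEquiv_pi_matrix_divisionRing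
    (MonoidAlgebra D G ⧸ Ring.jacobson (MonoidAlgebra D G))
  set π := Ideal.Quotient.mk (Ring.jacobson (MonoidAlgebra D G)) with hπ
  suffices STU (e (π x)) by
    simpa using this.map e.symm.toRingHom
  apply stu_pi
  intro i
  by_cases hi : ∃ b : D' i, b ≠ 0 ∧ b ≠ 1
  · obtain ⟨b, hb0, hb1⟩ := hi
    exact stu_matrix (stu_division hb0 hb1) _ _
  exfalso
  push Not at hi
  have hfin : Finite (D' i) := by
    refine Finite.of_surjective (fun b : Bool => if b then (1 : D' i) else 0) fun y => ?_
    by_cases hy : y = 0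
    · exact ⟨false, by simp [hy]⟩
    · exact ⟨true, by simp [hi y hy]⟩
  have : NeZero (d i) := hd i
  let p : MonoidAlgebra D G →+* Matrix (Fin (d i)) (Fin (d i)) (D' i) :=
    (Pi.evalRingHom (fun i => Matrix (Fin (d i)) (Fin (d i)) (D' i)) i).comp (e.toRingHom.comp π)
  have hp : Function.Surjective p := by
    intro y
    obtain ⟨z, hz⟩ := Ideal.Quotient.mk_surjective (e.symm (Pi.single i y))
    refine ⟨z, ?_⟩
    change e (π z) i = y
    rw [hπ, hz]; simp
  let q : D →+* Matrix (Fin (d i)) (Fin (d i)) (D' i) := p.comp MonoidAlgebra.singleOneRingHom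
  have hD : Finite D := Finite.of_injective q q.injective
  have hcomm : ∀ b : D, a * b = b * a := fun b => (littleWedderburn D).mul_comm a b
  have hcen : ∀ y : MonoidAlgebra D G, Commute (MonoidAlgebra.single 1 a) y := by
    intro y
    ext g
    simp [hcomm]
  have hq : ∀ X, Commute (q a) X := by
    intro X
    obtain ⟨y, rfl⟩ := hp X
    exact (hcen y).map p
  obtain ⟨c, hc⟩ := Matrix.mem_range_scalar_of_commute_single (M := q a)
    (fun i j _ => (hq _).symm)
  by_cases hc0 : c = 0
  · apply h0
    apply q.injective
    rw [← hc, hc0, map_zero, map_zero]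
  · apply h1
    apply q.injective
    rw [← hc, hi c hc0, map_one, map_one]

/-! ### Approximate solutions modulo ideals -/

/-- `x` is a sum of two units modulo `I`. -/
def Good {R G : Type*} [Ring R] [Group G] (x : MonoidAlgebra R G) (I : Ideal R) : Prop :=
  ∃ u u' v v' : MonoidAlgebra R G, (∀ g, (x - (u + v)).coeff g ∈ I) ∧
    (∀ g, (u * u' - 1).coeff g ∈ I) ∧ (∀ g, (u' * u - 1).coeff g ∈ I) ∧
    (∀ g, (v * v' - 1).coeff g ∈ I) ∧ (∀ g, (v' * v - 1).coeff g ∈ I)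

section
variable {R S G : Type*} [Ring R] [Ring S] [Group G]

lemma Good.map {x : MonoidAlgebra R G} (f : R →+* S) {K : Ideal S} (h : Good x (K.comap f)) :
    Good (MonoidAlgebra.mapRingHom G f x) K := by
  obtain ⟨u, u', v, v', h, h1, h2, h3, h4⟩ := h
  refine ⟨MonoidAlgebra.mapRingHom G f u, MonoidAlgebra.mapRingHom G f u',
    MonoidAlgebra.mapRingHom G f v, MonoidAlgebra.mapRingHom G f v', ?_⟩
  simp only [← map_mul, ← map_add, ← map_sub, ← map_one (MonoidAlgebra.mapRingHom G f),
    MonoidAlgebra.coeff_mapRingHom]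
  exact ⟨h, h1, h2, h3, h4⟩

lemma Good.of_stu {x : MonoidAlgebra R G} (f : R →+* S) (hf : Function.Surjective f)
    (h : STU (MonoidAlgebra.mapRingHom G f x)) : Good x (RingHom.ker f) := by
  have hs : Function.Surjective (MonoidAlgebra.mapRingHom G f) := by
    intro y
    induction y using MonoidAlgebra.induction_linear with
    | zero => exact ⟨0, map_zero _⟩
    | add a b ha hb =>
      obtain ⟨a, rfl⟩ := ha
      obtain ⟨b, rfl⟩ := hb
      exact ⟨a + b, map_add _ _ _⟩
    | single g s =>
      obtain ⟨r, rfl⟩ := hf s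
      exact ⟨MonoidAlgebra.single g r, MonoidAlgebra.mapRingHom_single f g r⟩
  obtain ⟨u, v, ⟨⟨u, u', h1, h2⟩, rfl⟩, ⟨⟨v, v', h3, h4⟩, rfl⟩, hx⟩ := h
  obtain ⟨u, rfl⟩ := hs u
  obtain ⟨u', rfl⟩ := hs u'
  obtain ⟨v, rfl⟩ := hs v
  obtain ⟨v', rfl⟩ := hs v'
  refine ⟨u, u', v, v', ?_⟩
  simp only [RingHom.mem_ker, ← MonoidAlgebra.coeff_mapRingHom]
  simp only [map_sub, map_mul, map_add, map_one]
  simp only at hx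
  rw [h1, h2, h3, h4, hx]
  simp

lemma coeff_mem_sSup {c : Set (Ideal R)} (hc : IsChain (· ≤ ·) c) (hne : c.Nonempty)
    (z : MonoidAlgebra R G) (h : ∀ g, z.coeff g ∈ sSup c) :
    ∃ I ∈ c, ∀ g, z.coeff g ∈ I := by
  classical
  have key : ∀ s : Finset G, ∃ I ∈ c, ∀ g ∈ s, z.coeff g ∈ I := by
    intro s
    induction s using Finset.induction_on with
    | empty => obtain ⟨I, hI⟩ := hne; exact ⟨I, hI, by simp⟩
    | insert a s _ ih =>
      obtain ⟨I, hI, hs⟩ := ih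
      obtain ⟨J, hJ, ha⟩ := (Submodule.mem_sSup_of_directed hne hc.directedOn).1 (h a)
      obtain ⟨K, hK, hIK, hJK⟩ := hc.directedOn I hI J hJ
      refine ⟨K, hK, fun g hg => ?_⟩
      rcases Finset.mem_insert.1 hg with rfl | hg
      · exact hJK ha
      · exact hIK (hs g hg)
  obtain ⟨I, hI, hs⟩ := key z.coeff.support
  refine ⟨I, hI, fun g => ?_⟩
  by_cases hg : z.coeff g = 0
  · rw [hg]; exact zero_mem _
  · exact hs g (Finsupp.mem_support_iff.2 hg)

lemma Good.of_sSup {c : Set (Ideal R)} (hc : IsChain (· ≤ ·) c) (hne : c.Nonempty)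
    {x : MonoidAlgebra R G} (h : Good x (sSup c)) : ∃ I ∈ c, Good x I := by
  obtain ⟨u, u', v, v', h, h1, h2, h3, h4⟩ := h
  obtain ⟨I0, m0, h⟩ := coeff_mem_sSup hc hne _ h
  obtain ⟨I1, m1, h1⟩ := coeff_mem_sSup hc hne _ h1
  obtain ⟨I2, m2, h2⟩ := coeff_mem_sSup hc hne _ h2
  obtain ⟨I3, m3, h3⟩ := coeff_mem_sSup hc hne _ h3
  obtain ⟨I4, m4, h4⟩ := coeff_mem_sSup hc hne _ h4
  obtain ⟨J1, n1, a0, a1⟩ := hc.directedOn I0 m0 I1 m1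
  obtain ⟨J2, n2, b1, a2⟩ := hc.directedOn J1 n1 I2 m2
  obtain ⟨J3, n3, b2, a3⟩ := hc.directedOn J2 n2 I3 m3
  obtain ⟨J4, n4, b3, a4⟩ := hc.directedOn J3 n3 I4 m4
  exact ⟨J4, n4, u, u', v, v', fun g => b3 (b2 (b1 (a0 (h g)))), fun g => b3 (b2 (b1 (a1 (h1 g)))),
    fun g => b3 (b2 (a2 (h2 g))), fun g => b3 (a3 (h3 g)), fun g => a4 (h4 g)⟩

lemma mem_jac_of_coeff [Finite G] {z : MonoidAlgebra R G} (h : ∀ g, z.coeff g ∈ Ring.jacobson R) :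
    z ∈ Ring.jacobson (MonoidAlgebra R G) := by
  have hsm : ∀ w : MonoidAlgebra R G, (∀ g, w.coeff g ∈ Ring.jacobson R) →
      w ∈ Ring.jacobson R • (⊤ : Submodule R (MonoidAlgebra R G)) := by
    intro w hw
    rw [← MonoidAlgebra.sum_coeff_single w]
    refine Submodule.sum_mem _ fun g _ => ?_
    have : MonoidAlgebra.single g (w.coeff g) = w.coeff g • MonoidAlgebra.single g (1 : R) := by
      simp
    rw [this]
    exact Submodule.smul_mem_smul (hw g) trivial
  have hmul : ∀ y : MonoidAlgebra R G, ∀ g, (y * z).coeff g ∈ Ring.jacobson R := by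
    intro y
    induction y using MonoidAlgebra.induction_linear with
    | zero => simp
    | add a b ha hb =>
      intro g
      rw [add_mul, MonoidAlgebra.coeff_add]
      exact add_mem (ha g) (hb g)
    | single k s =>
      intro g
      rw [MonoidAlgebra.coeff_single_mul_eq_mul_coeff (k⁻¹ * g) (by
        intro m' _
        rw [eq_inv_mul_iff_mul_eq])]
      exact Ideal.mul_mem_left _ _ (h _)
  rw [← Ideal.jacobson_bot, Ideal.mem_jacobson_iff]
  intro y
  let t := y * z + 1
  let N : Submodule R (MonoidAlgebra R G) := (Ideal.span {t}).restrictScalars R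
  have hN : Ring.jacobson R • (⊤ : Submodule R (MonoidAlgebra R G)) ⊔ N = ⊤ := by
    rw [eq_top_iff]
    intro w _
    have : w = -(w * y * z) + w * t := by simp only [t]; noncomm_ring
    rw [this]
    refine Submodule.add_mem_sup (neg_mem (hsm _ (hmul _))) ?_
    exact Ideal.mul_mem_left _ _ (Ideal.subset_span rfl)
  have hNtop : N = ⊤ := by
    by_contra hne
    have : Nontrivial (MonoidAlgebra R G ⧸ N) := Submodule.Quotient.nontrivial_iff.2 hne
    have h2 := congrArg (Submodule.map N.mkQ) hN
    rw [Submodule.map_sup, Submodule.mkQ_map_self, sup_bot_eq, Submodule.map_smul''] at h2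
    have h3 := Submodule.jacobson_smul_lt_top (R := R) (Submodule.map N.mkQ ⊤)
    rw [h2, Submodule.map_top, Submodule.range_mkQ] at h3
    exact lt_irrefl _ h3
  have h1 : (1 : MonoidAlgebra R G) ∈ N := hNtop ▸ trivial
  obtain ⟨w, hw⟩ := Ideal.mem_span_singleton'.1 (show (1 : MonoidAlgebra R G) ∈ Ideal.span {t} from h1)
  refine ⟨w, ?_⟩
  rw [Ideal.mem_bot, sub_eq_zero, ← hw]
  simp only [t]; noncomm_ring

lemma Good.lift_jac [Finite G] {x : MonoidAlgebra R G} (h : Good x (Ring.jacobson R)) : STU x := by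
  obtain ⟨u, u', v, v', h, h1, h2, h3, h4⟩ := h
  exact STU.of_jac (mem_jac_of_coeff h) (mem_jac_of_coeff h1) (mem_jac_of_coeff h2)
    (mem_jac_of_coeff h3) (mem_jac_of_coeff h4)

/-- The annihilator of a central element. -/
def annC (e : R) (he : ∀ r, e * r = r * e) : Ideal R where
  carrier := {r | e * r = 0}
  zero_mem' := mul_zero e
  add_mem' := by
    intro a b (ha : e * a = 0) (hb : e * b = 0)
    change e * (a + b) = 0
    rw [mul_add, ha, hb, add_zero]
  smul_mem' := by
    intro c a (ha : e * a = 0)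
    change e * (c * a) = 0
    rw [← mul_assoc, he, mul_assoc, ha, mul_zero]

lemma annC_twoSided (e : R) (he : ∀ r, e * r = r * e) : (annC e he).IsTwoSided :=
  ⟨fun {a} b (ha : e * a = 0) => show e * (a * b) = 0 by rw [← mul_assoc, ha, zero_mul]⟩

lemma glue_mul {A : Type*} [Ring A] {c p p' q q' : A} (hc : c * c = c) (hcen : ∀ a, c * a = a * c)
    (h1 : c * (p * p' - 1) = 0) (h2 : (1 - c) * (q * q' - 1) = 0) :
    (c * p + (1 - c) * q) * (c * p' + (1 - c) * q') = 1 := by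
  have e1 : c * (1 - c) = 0 := by rw [mul_sub, hc, mul_one, sub_self]
  have e2 : (1 - c) * c = 0 := by rw [sub_mul, hc, one_mul, sub_self]
  have e3 : (1 - c) * (1 - c) = 1 - c := by rw [mul_sub, e2, mul_one, sub_zero]
  have hcen' : ∀ a, (1 - c) * a = a * (1 - c) := fun a => by
    rw [sub_mul, mul_sub, hcen, one_mul, mul_one]
  rw [mul_sub, mul_one, sub_eq_zero] at h1 h2
  calc _ = c * (p * c) * p' + c * (p * (1 - c)) * q' + (1 - c) * (q * c) * p'
        + (1 - c) * (q * (1 - c)) * q' := by noncomm_ring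
    _ = (c * c) * (p * p') + (c * (1 - c)) * (p * q') + ((1 - c) * c) * (q * p')
        + ((1 - c) * (1 - c)) * (q * q') := by
      rw [← hcen p, ← hcen q, ← hcen' p, ← hcen' q]; noncomm_ring
    _ = 1 := by rw [e1, e2, e3, hc, h1, h2]; noncomm_ring

lemma stu_glue (e : R) (hee : e * e = e) (he : ∀ r, e * r = r * e) (he' : ∀ r, (1 - e) * r = r * (1 - e))
    {x : MonoidAlgebra R G} (h1 : Good x (annC e he)) (h2 : Good x (annC (1 - e) he')) : STU x := by
  let c : MonoidAlgebra R G := MonoidAlgebra.single 1 e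
  have hc : c * c = c := by simp [c, MonoidAlgebra.single_mul_single, hee]
  have hcen : ∀ a, c * a = a * c := by
    intro a
    ext g
    simp [c, he]
  have k1 : ∀ z : MonoidAlgebra R G, (∀ g, z.coeff g ∈ annC e he) → c * z = 0 := by
    intro z hz
    ext g
    rw [MonoidAlgebra.coeff_single_one_mul]
    exact hz g
  have hc' : 1 - c = MonoidAlgebra.single 1 (1 - e) := by
    simp [c, MonoidAlgebra.single_sub, MonoidAlgebra.one_def]
  have k2 : ∀ z : MonoidAlgebra R G, (∀ g, z.coeff g ∈ annC (1 - e) he') → (1 - c) * z = 0 := by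
    intro z hz
    rw [hc']
    ext g
    rw [MonoidAlgebra.coeff_single_one_mul]
    exact hz g
  obtain ⟨u, u', v, v', a0, a1, a2, a3, a4⟩ := h1
  obtain ⟨w, w', z, z', b0, b1, b2, b3, b4⟩ := h2
  refine ⟨c * u + (1 - c) * w, c * v + (1 - c) * z,
    ⟨⟨_, c * u' + (1 - c) * w', glue_mul hc hcen (k1 _ a1) (k2 _ b1),
      glue_mul hc hcen (k1 _ a2) (k2 _ b2)⟩, rfl⟩,
    ⟨⟨_, c * v' + (1 - c) * z', glue_mul hc hcen (k1 _ a3) (k2 _ b3),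
      glue_mul hc hcen (k1 _ a4) (k2 _ b4)⟩, rfl⟩, ?_⟩
  have c1 := k1 _ a0
  have c2 := k2 _ b0
  rw [mul_sub, sub_eq_zero] at c1 c2
  calc x = c * x + (1 - c) * x := by noncomm_ring
    _ = _ := by rw [c1, c2]; noncomm_ring

lemma stu_core [Finite G]
    (habelian : ∀ e : R, IsIdempotentElem e → ∀ r : R, e * r = r * e)
    (hexchange : ∀ a : R, ∃ e : R, IsIdempotentElem e ∧
      (∃ r : R, e = a * r) ∧ (∃ s : R, 1 - e = (1 - a) * s))
    (hfactor : ¬ ∃ f : R →+* ZMod 2, Function.Surjective f)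
    (x : MonoidAlgebra R G) (hgood : ∀ K : Ideal R, K.IsTwoSided → K ≠ ⊥ → Good x K) : STU x := by
  by_contra hx
  have hnt : Nontrivial R := by
    by_contra hn
    rw [not_nontrivial_iff_subsingleton] at hn
    have : Subsingleton (MonoidAlgebra R G) := ⟨fun a b => by ext; exact Subsingleton.elim _ _⟩
    exact hx ⟨0, 0, isUnit_of_subsingleton _, isUnit_of_subsingleton _, Subsingleton.elim _ _⟩
  -- the only idempotents are trivial
  have hid : ∀ e : R, IsIdempotentElem e → e = 0 ∨ e = 1 := by
    intro e hee
    by_contra hne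
    push Not at hne
    have h1 := habelian e hee
    have h2 := habelian (1 - e) hee.one_sub
    refine hx (stu_glue e hee h1 h2 (hgood _ (annC_twoSided _ _) fun h => ?_)
      (hgood _ (annC_twoSided _ _) fun h => ?_))
    · have : 1 - e ∈ annC e h1 := show e * (1 - e) = 0 by rw [mul_sub, hee.eq, mul_one, sub_self]
      rw [h, Ideal.mem_bot, sub_eq_zero] at this
      exact hne.2 this.symm
    · have : e ∈ annC (1 - e) h2 := show (1 - e) * e = 0 by rw [sub_mul, hee.eq, one_mul, sub_self]
      rw [h, Ideal.mem_bot] at this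
      exact hne.1 this
  have hunit : ∀ a b : R, a * b = 1 → IsUnit a ∧ IsUnit b := by
    intro a b hab
    have : b * a = 1 := by
      have hi : IsIdempotentElem (b * a) := by
        change b * a * (b * a) = b * a
        rw [mul_assoc, ← mul_assoc a, hab, one_mul]
      rcases hid _ hi with h | h
      · exfalso
        have : (1 : R) = a * (b * a) * b := by rw [← mul_assoc, hab, one_mul, hab]
        rw [h, mul_zero, zero_mul] at this
        exact one_ne_zero this
      · exact h
    exact ⟨⟨⟨a, b, hab, this⟩, rfl⟩, ⟨⟨b, a, this, hab⟩, rfl⟩⟩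
  have hloc : ∀ a : R, IsUnit a ∨ IsUnit (1 - a) := by
    intro a
    obtain ⟨e, hee, ⟨r, hr⟩, ⟨s, hs⟩⟩ := hexchange a
    rcases hid e hee with rfl | rfl
    · right
      exact (hunit _ s (by rw [← hs, sub_zero])).1
    · left
      exact (hunit _ r hr.symm).1
  have hjac : Ring.jacobson R = ⊥ := by
    by_contra hne
    exact hx (hgood _ inferInstance hne).lift_jac
  have hdiv : ∀ a : R, IsUnit a ∨ a = 0 := by
    intro a
    by_cases ha : a = 0
    · exact Or.inr ha
    left
    have : a ∉ Ring.jacobson R := by rwa [hjac, Ideal.mem_bot]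
    rw [← Ideal.jacobson_bot, Ideal.mem_jacobson_iff] at this
    push Not at this
    obtain ⟨y, hy⟩ := this
    rcases hloc (-(y * a)) with h | h
    · obtain ⟨b, hb⟩ := h.exists_left_inv
      exact (hunit (-(b * y)) a (by rw [← hb]; noncomm_ring)).2
    · obtain ⟨b, hb⟩ := h.exists_left_inv
      exfalso
      apply hy b
      rw [Ideal.mem_bot, sub_eq_zero, ← hb]; noncomm_ring
  have hthree : ∃ a : R, a ≠ 0 ∧ a ≠ 1 := by
    by_contra hno
    push Not at hno
    apply hfactor
    classical
    let φ : Bool ≃ R :=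
      { toFun := fun b => if b then 1 else 0
        invFun := fun r => decide (r ≠ 0)
        left_inv := by intro b; cases b <;> simp
        right_inv := by
          intro r
          by_cases hr : r = 0
          · simp [hr]
          · simp [hno r hr] }
    letI : Fintype R := Fintype.ofEquiv Bool φ
    have hcard : Fintype.card R = 2 := by
      rw [← Fintype.card_congr φ]; rfl
    let ψ := (ZMod.ringEquivOfPrime R Nat.prime_two hcard).symm
    exact ⟨ψ.toRingHom, ψ.surjective⟩
  obtain ⟨a, h0, h1⟩ := hthree
  exact hx (@stu_groupRing_division R G (DivisionRing.ofIsUnitOrEqZero hdiv) _ _ a h0 h1 x)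

theorem stu_finite [Finite G]
    (habelian : ∀ e : R, IsIdempotentElem e → ∀ r : R, e * r = r * e)
    (hexchange : ∀ a : R, ∃ e : R, IsIdempotentElem e ∧
      (∃ r : R, e = a * r) ∧ (∃ s : R, 1 - e = (1 - a) * s))
    (hfactor : ¬ ∃ f : R →+* ZMod 2, Function.Surjective f)
    (x : MonoidAlgebra R G) : STU x := by
  by_contra hx
  have hbot : ¬ Good x (⊥ : Ideal R) := by
    intro h
    obtain ⟨u, u', v, v', h, h1, h2, h3, h4⟩ := h
    have key : ∀ z : MonoidAlgebra R G, (∀ g, z.coeff g ∈ (⊥ : Ideal R)) →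
        z ∈ Ring.jacobson (MonoidAlgebra R G) := by
      intro z hz
      have : z = 0 := by ext g; simpa using hz g
      rw [this]; exact zero_mem _
    exact hx (STU.of_jac (key _ h) (key _ h1) (key _ h2) (key _ h3) (key _ h4))
  obtain ⟨I, -, ⟨hI2, hIbad⟩, hImax⟩ := zorn_le_nonempty₀ {I : Ideal R | I.IsTwoSided ∧ ¬ Good x I}
    (by
      intro c hcs hc I0 hI0
      have hne : c.Nonempty := ⟨I0, hI0⟩
      refine ⟨sSup c, ⟨⟨fun {a} b ha => ?_⟩, fun hg => ?_⟩, fun z hz => le_sSup hz⟩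
      · obtain ⟨J, hJ, haJ⟩ := (Submodule.mem_sSup_of_directed hne hc.directedOn).1 ha
        have : Ideal.IsTwoSided J := (hcs hJ).1
        exact (Submodule.mem_sSup_of_directed hne hc.directedOn).2 ⟨J, hJ, Ideal.mul_mem_right b J haJ⟩
      · obtain ⟨J, hJ, hgJ⟩ := hg.of_sSup hc hne
        exact (hcs hJ).2 hgJ) ⊥ ⟨inferInstance, hbot⟩
  set π := Ideal.Quotient.mk I with hπ
  have hsurj : Function.Surjective π := Ideal.Quotient.mk_surjective
  apply hIbad
  have hk : RingHom.ker π = I := Ideal.mk_ker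
  rw [← hk]
  apply Good.of_stu π hsurj
  apply stu_core
  · intro e hee r
    obtain ⟨a, rfl⟩ := hsurj e
    obtain ⟨r, rfl⟩ := hsurj r
    obtain ⟨f, hf, ⟨t, ht⟩, ⟨s, hs⟩⟩ := hexchange a
    have h1 : π a * π f = π f := by
      rw [ht, map_mul, ← mul_assoc, hee.eq]
    have h2 : π a * π (1 - f) = 0 := by
      rw [hs, map_mul, ← mul_assoc, map_sub, map_one, mul_sub, hee.eq, mul_one, sub_self, zero_mul]
    have h3 : π a = π f := by
      rw [map_sub, map_one, mul_sub, mul_one, h1, sub_eq_zero] at h2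
      exact h2
    rw [h3, ← map_mul, ← map_mul, habelian f hf]
  · intro a
    obtain ⟨a, rfl⟩ := hsurj a
    obtain ⟨f, hf, ⟨t, ht⟩, ⟨s, hs⟩⟩ := hexchange a
    refine ⟨π f, hf.map π, ⟨π t, ?_⟩, ⟨π s, ?_⟩⟩
    · rw [← map_mul, ← ht]
    · rw [← map_one π, ← map_sub, ← map_sub, ← map_mul, ← hs]
  · rintro ⟨f, hf⟩
    exact hfactor ⟨f.comp π, hf.comp hsurj⟩
  · intro K hK hKbot
    apply Good.map
    by_contra hb
    apply hKbot
    have hle : K.comap π ≤ I := hImax ⟨inferInstance, hb⟩ (by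
      intro r hr
      rw [Ideal.mem_comap, Ideal.Quotient.eq_zero_iff_mem.2 hr]
      exact zero_mem _)
    rw [eq_bot_iff]
    intro k hk
    obtain ⟨r, rfl⟩ := hsurj k
    exact Ideal.Quotient.eq_zero_iff_mem.2 (hle hk)

end


/-- Let `R` be an Abelian exchange ring and `G` a locally finite group.  If `R` has no
factor ring isomorphic to `ℤ/2ℤ`, then every element of the group ring `RG` is a sum of
two units. -/
theorem monoidAlgebra_every_element_sum_of_two_units {R : Type*} [Ring R]
    {G : Type*} [Group G]
    (habelian : ∀ e : R, IsIdempotentElem e → ∀ r : R, e * r = r * e)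
    (hexchange : ∀ a : R, ∃ e : R, IsIdempotentElem e ∧
      (∃ r : R, e = a * r) ∧ (∃ s : R, 1 - e = (1 - a) * s))
    (hLF : ∀ s : Finset G, Finite (Subgroup.closure (s : Set G)))
    (hfactor : ¬ ∃ f : R →+* ZMod 2, Function.Surjective f) :
    ∀ x : MonoidAlgebra R G, ∃ u v : MonoidAlgebra R G,
      IsUnit u ∧ IsUnit v ∧ x = u + v := by
  intro x
  set H := Subgroup.closure ((x.coeff.support : Finset G) : Set G) with hH
  have hfin : Finite H := hLF _
  have hrange : x ∈ (MonoidAlgebra.mapDomainRingHom R H.subtype).range := by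
    rw [← MonoidAlgebra.sum_coeff_single x]
    refine sum_mem fun g hg => ?_
    refine ⟨MonoidAlgebra.single ⟨g, Subgroup.subset_closure hg⟩ (x.coeff g), ?_⟩
    simp
  obtain ⟨y, hy⟩ := hrange
  have := (stu_finite habelian hexchange hfactor y).map (MonoidAlgebra.mapDomainRingHom R H.subtype)
  rw [hy] at this
  exact this
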